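/- Let p, q, r ≥ 2 be integers, and let f₁ = xy − z^p − t^q and f₂ = zt − x^r in ℂ[x,y,z,t]. Then the set of points P ∈ ℂ⁴ with f₁(P) = f₂(P) = 0 at which all 2×2 minors of the Jacobian matrix of (f₁, f₂) vanish equals the line {x = z = t = 0}; in particular the singular locus of the surface is a smooth irreducible curve. -/

import Mathlib

open MvPolynomial

/-- For p, q, r ≥ 2, f₁ = xy − z^p − t^q and f₂ = zt − x^r, the set of points of
(f₁ = f₂ = 0) ⊂ ℂ⁴ where all 2×2 minors of the Jacobian of (f₁, f₂) vanish is
the line {x = z = t = 0}. -/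
theorem T4pqr_singular_locus (p q r : ℕ) (hp : 2 ≤ p) (hq : 2 ≤ q) (hr : 2 ≤ r) :
    {P : Fin 4 → ℂ |
        eval P (X 0 * X 1 - X 2 ^ p - X 3 ^ q : MvPolynomial (Fin 4) ℂ) = 0 ∧
        eval P (X 2 * X 3 - X 0 ^ r : MvPolynomial (Fin 4) ℂ) = 0 ∧
        ∀ i j : Fin 4,
          eval P (pderiv i (X 0 * X 1 - X 2 ^ p - X 3 ^ q : MvPolynomial (Fin 4) ℂ)) *
              eval P (pderiv j (X 2 * X 3 - X 0 ^ r : MvPolynomial (Fin 4) ℂ)) -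
            eval P (pderiv j (X 0 * X 1 - X 2 ^ p - X 3 ^ q : MvPolynomial (Fin 4) ℂ)) *
              eval P (pderiv i (X 2 * X 3 - X 0 ^ r : MvPolynomial (Fin 4) ℂ)) = 0} =
      {P : Fin 4 → ℂ | P 0 = 0 ∧ P 2 = 0 ∧ P 3 = 0} := by
  ext P
  simp only [Set.mem_ofPred_eq]
  constructor
  · rintro ⟨h₁, h₂, h⟩
    have hxz := h 1 3
    simp [pderiv_X] at h₁ h₂ hxz
    have hx : P 0 = 0 := by
      by_contra hx
      have hz : P 2 = 0 := by simpa [hx] using hxz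
      have hpow : P 0 ^ r = 0 := by simpa [hz] using h₂
      exact hx (pow_eq_zero_iff (by lia) |>.1 hpow)
    have hzt : P 2 = 0 ∨ P 3 = 0 := by
      simpa [hx, show r ≠ 0 by lia] using h₂
    rcases hzt with hz | ht
    · exact ⟨hx, hz, by simpa [hx, hz, show p ≠ 0 by lia, show q ≠ 0 by lia] using h₁⟩
    · exact ⟨hx, by simpa [hx, ht, show p ≠ 0 by lia, show q ≠ 0 by lia] using h₁, ht⟩
  · rintro ⟨hx, hz, ht⟩
    have hgrad (i : Fin 4) :
        eval P (pderiv i (X 2 * X 3 - X 0 ^ r : MvPolynomial (Fin 4) ℂ)) = 0 := by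
      simp [hx, hz, ht, show r - 1 ≠ 0 by lia]
    refine ⟨?_, ?_, fun i j => by rw [hgrad, hgrad, mul_zero, mul_zero, sub_zero]⟩
    · simp [hx, hz, ht, show p ≠ 0 by lia, show q ≠ 0 by lia]
    · simp [hx, hz, show r ≠ 0 by lia]
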